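/- arXiv:2109.11668 — 9 statements merged into one kernel-verified Lean document; each statement's English description precedes it below -/
import Mathlib

section
/- Let n ≥ 2 and p ≥ 2. The teaching dimension of the class F_c of complete scenarios equals n(n-1)/2, i.e., TDim(F_c) = n(n-1)/2: every concept in F_c has a teaching set of cardinality n(n-1)/2, and some concept in F_c has no teaching set of cardinality smaller than n(n-1)/2. -/
open Finset

/-- Unordered pairs of distinct entities among `n` entities. -/
abbrev Pairs (n : ℕ) := {s : Sym2 (Fin n) // ¬ s.IsDiag}

/-- The instance space `X = S × R`. -/
abbrev QInstance (n p : ℕ) := Pairs n × Fin p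

/-- `T` is a teaching set for `f` w.r.t. the concept class `F`:
every concept of `F` agreeing with `f` on `T` equals `f`. -/
def IsTeachingSet {n p : ℕ} (F : (QInstance n p → Bool) → Prop)
    (f : QInstance n p → Bool) (T : Finset (QInstance n p)) : Prop :=
  ∀ f', F f' → (∀ x ∈ T, f' x = f x) → f' = f

/-- The class `F_c` of complete scenarios. -/
def IsCompleteScenario {n p : ℕ} (f : QInstance n p → Bool) : Prop :=
  ∃ g : Pairs n → Fin p, ∀ s r, (f (s, r) = true ↔ g s = r)

/-- The class `F_inc` of incomplete scenarios (`none` encodes the universal relation). -/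
def IsIncomplete {n p : ℕ} (f : QInstance n p → Bool) : Prop :=
  ∃ g : Pairs n → Option (Fin p), ∀ s r, (f (s, r) = true ↔ (g s = none ∨ g s = some r))

/-- The class `F_all` of general QCN concepts. -/
def IsAll {n p : ℕ} (f : QInstance n p → Bool) : Prop :=
  ∃ g : Pairs n → Finset (Fin p), (∀ s, (g s).Nonempty) ∧ ∀ s r, (f (s, r) = true ↔ r ∈ g s)

/-- There are `n(n-1)/2` unordered pairs of distinct entities. -/
lemma card_pairs (n : ℕ) : Fintype.card (Pairs n) = n * (n - 1) / 2 := by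
  rw [Sym2.card_subtype_not_diag, Fintype.card_fin, Nat.choose_two_right]

lemma IsCompleteScenario.exists_teachingSet {n p : ℕ} {f : QInstance n p → Bool}
    (hf : IsCompleteScenario f) :
    ∃ T : Finset (QInstance n p),
      IsTeachingSet IsCompleteScenario f T ∧ T.card = Fintype.card (Pairs n) := by
  obtain ⟨g, hg⟩ := hf
  refine ⟨univ.map ⟨fun s => (s, g s), fun s t h => congrArg Prod.fst h⟩, ?_, by simp⟩
  rintro f' ⟨g', hg'⟩ hagree
  have hgg' : ∀ s, g' s = g s := fun s => by
    rw [← hg', hagree (s, g s) (mem_map.2 ⟨s, mem_univ s, rfl⟩)]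
    exact (hg _ _).2 rfl
  funext ⟨s, r⟩
  rw [Bool.eq_iff_iff, hg', hg, hgg']

/-- With at least two relations, a teaching set of a complete scenario must query every pair. -/
lemma IsTeachingSet.card_pairs_le {n p : ℕ} (hp : 2 ≤ p) {f : QInstance n p → Bool}
    (hf : IsCompleteScenario f) {T : Finset (QInstance n p)}
    (hT : IsTeachingSet IsCompleteScenario f T) : Fintype.card (Pairs n) ≤ T.card := by
  classical
  obtain ⟨g, hg⟩ := hf
  have : Nontrivial (Fin p) := Fin.nontrivial_iff_two_le.2 hp
  suffices h : T.image Prod.fst = univ by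
    rw [← card_univ, ← h]
    exact card_image_le
  rw [eq_univ_iff_forall]
  intro s
  by_contra hs
  obtain ⟨r, hr⟩ := exists_ne (g s)
  have hf' := hT (fun x => decide (Function.update g s r x.1 = x.2))
    ⟨Function.update g s r, fun t q => by simp⟩ fun ⟨t, q⟩ hx => by
      have hts : t ≠ s := fun h => hs (mem_image.2 ⟨_, hx, h⟩)
      rw [Bool.eq_iff_iff, hg]
      simp [hts]
  have hsr : f (s, r) = true := by simp [← hf']
  exact hr ((hg s r).1 hsr).symm

/-- `TDim(F_c) = n(n-1)/2`. -/
theorem stmt_0 (n p : ℕ) (hn : 2 ≤ n) (hp : 2 ≤ p) :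
    (∀ f : QInstance n p → Bool, IsCompleteScenario f →
      ∃ T : Finset (QInstance n p), IsTeachingSet IsCompleteScenario f T ∧ T.card = n * (n - 1) / 2) ∧
    (∃ f : QInstance n p → Bool, IsCompleteScenario f ∧
      ∀ T : Finset (QInstance n p), IsTeachingSet IsCompleteScenario f T → n * (n - 1) / 2 ≤ T.card) := by
  rw [← card_pairs]
  exact ⟨fun f hf => hf.exists_teachingSet,
    fun x => decide (⟨0, by omega⟩ = x.2), ⟨fun _ => ⟨0, by omega⟩, by simp⟩,
    fun T hT => hT.card_pairs_le hp ⟨fun _ => ⟨0, by omega⟩, by simp⟩⟩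
end

section
/- Let n ≥ 2 and p ≥ 1. For every concept f in the class F_c of complete scenarios with witness g : S → R, the set T = {(s, g(s)) : s ∈ S} of one positive example per pair is a teaching set for f with respect to F_c; in particular every f ∈ F_c has a teaching set of cardinality at most n(n-1)/2. -/
open Finset

/-- one positive example per pair is a teaching set for a complete scenario. -/
theorem stmt_1 (n p : ℕ) (hn : 2 ≤ n) (hp : 1 ≤ p)
    (f : QInstance n p → Bool) (g : Pairs n → Fin p)
    (hg : ∀ s r, f (s, r) = true ↔ g s = r) :
    IsTeachingSet IsCompleteScenario f (Finset.univ.image fun s : Pairs n => (s, g s)) ∧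
    (Finset.univ.image fun s : Pairs n => (s, g s)).card ≤ n * (n - 1) / 2 := by
  refine ⟨?_, ?_⟩
  · rintro f' ⟨g', hg'⟩ hagree
    have hgg : ∀ s, g' s = g s := fun s => by
      have h := hagree (s, g s) (Finset.mem_image_of_mem _ (Finset.mem_univ s))
      exact (hg' s (g s)).1 (h.trans ((hg s (g s)).2 rfl))
    funext ⟨s, r⟩
    rw [Bool.eq_iff_iff, hg', hg, hgg]
  · calc (Finset.univ.image fun s : Pairs n => (s, g s)).card
        ≤ Fintype.card (Pairs n) := Finset.card_image_le
      _ = n * (n - 1) / 2 := by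
        rw [Sym2.card_subtype_not_diag, Fintype.card_fin, Nat.choose_two_right]
end

section
/- Let n ≥ 2 and p ≥ 2. There exists a concept f in the class F_c of complete scenarios such that every teaching set for f with respect to F_c has cardinality at least n(n-1)/2. -/
open Finset

/-- A teaching set for a complete scenario contains an instance over every pair of entities. -/
lemma IsTeachingSet.image_fst_eq_univ {n p : ℕ} (hp : 2 ≤ p) {f : QInstance n p → Bool}
    (hf : IsCompleteScenario f) {T : Finset (QInstance n p)}
    (hT : IsTeachingSet IsCompleteScenario f T) : T.image Prod.fst = univ := by
  rw [eq_univ_iff_forall]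
  by_contra! ⟨s, hs⟩
  obtain ⟨g, hg⟩ := hf
  have : Nontrivial (Fin p) := Fin.nontrivial_iff_two_le.mpr hp
  obtain ⟨r, hr⟩ := exists_ne (g s)
  have heq := hT (fun x => decide (Function.update g s r x.1 = x.2))
    ⟨Function.update g s r, fun _ _ => decide_eq_true_iff⟩ fun x hx => by
      have hne : x.1 ≠ s := fun h => hs (mem_image.mpr ⟨x, hx, h⟩)
      rw [Bool.eq_iff_iff, decide_eq_true_iff, Function.update_of_ne hne, ← hg]
  have hsr : f (s, r) = true := by simp [← heq]
  exact hr ((hg s r).mp hsr).symm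

/-- some complete scenario needs at least `n(n-1)/2` examples to teach. -/
theorem stmt_3 (n p : ℕ) (hn : 2 ≤ n) (hp : 2 ≤ p) :
    ∃ f : QInstance n p → Bool, IsCompleteScenario f ∧
      ∀ T : Finset (QInstance n p), IsTeachingSet IsCompleteScenario f T → n * (n - 1) / 2 ≤ T.card := by
  have : NeZero p := ⟨by omega⟩
  have hf : IsCompleteScenario (fun x : QInstance n p => decide ((0 : Fin p) = x.2)) :=
    ⟨fun _ => 0, fun _ _ => decide_eq_true_iff⟩
  refine ⟨_, hf, fun T hT => ?_⟩
  calc n * (n - 1) / 2 = Fintype.card (Pairs n) := by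
        rw [Sym2.card_subtype_not_diag, Fintype.card_fin, Nat.choose_two_right]
    _ = (T.image Prod.fst).card := by rw [hT.image_fst_eq_univ hp hf, card_univ]
    _ ≤ T.card := card_image_le
end

section
/- Let n ≥ 2 and p ≥ 2. Let f be a concept in the class F_c of complete scenarios with witness g : S → R, let s₀ ∈ S be any pair, and let r₀ ∈ R with r₀ ≠ g(s₀). Then the concept f' with witness g' defined by g'(s₀) = r₀ and g'(s) = g(s) for s ≠ s₀ belongs to F_c, differs from f, and agrees with f on every instance (s,r) with s ≠ s₀. In particular, any teaching set for f with respect to F_c must contain at least one instance on every pair s ∈ S. -/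
open Finset

/-- Overriding a complete scenario at one pair with a new relation gives a different complete
scenario that agrees with the original one on all other pairs. -/
theorem isCompleteScenario_update {n p : ℕ} {f : QInstance n p → Bool} {g : Pairs n → Fin p}
    (hg : ∀ s r, f (s, r) = true ↔ g s = r) {s₀ : Pairs n} {r₀ : Fin p} (hr₀ : r₀ ≠ g s₀) :
    let f' : QInstance n p → Bool := fun x => decide (Function.update g s₀ r₀ x.1 = x.2)
    IsCompleteScenario f' ∧ f' ≠ f ∧ ∀ s r, s ≠ s₀ → f' (s, r) = f (s, r) := by
  refine ⟨⟨Function.update g s₀ r₀, fun s r => decide_eq_true_iff⟩, fun h => ?_, fun s r hs => ?_⟩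
  · have h₀ := congrFun h (s₀, r₀)
    simp only [Function.update_self, decide_true] at h₀
    exact hr₀ ((hg s₀ r₀).1 h₀.symm).symm
  · rw [Bool.eq_iff_iff, hg, decide_eq_true_iff, Function.update_of_ne hs]

/-- modifying a complete scenario on a single pair yields another complete
scenario agreeing elsewhere; hence teaching sets must touch every pair. -/
theorem stmt_4 (n p : ℕ) (hn : 2 ≤ n) (hp : 2 ≤ p)
    (f : QInstance n p → Bool) (g : Pairs n → Fin p)
    (hg : ∀ s r, f (s, r) = true ↔ g s = r)
    (s₀ : Pairs n) (r₀ : Fin p) (hr₀ : r₀ ≠ g s₀) :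
    (let f' : QInstance n p → Bool := fun x => decide (Function.update g s₀ r₀ x.1 = x.2)
     IsCompleteScenario f' ∧ f' ≠ f ∧ ∀ s r, s ≠ s₀ → f' (s, r) = f (s, r)) ∧
    (∀ T : Finset (QInstance n p), IsTeachingSet IsCompleteScenario f T →
      ∀ s : Pairs n, ∃ r : Fin p, (s, r) ∈ T) := by
  refine ⟨isCompleteScenario_update hg hr₀, fun T hT s => ?_⟩
  have : Nontrivial (Fin p) := Fin.nontrivial_iff_two_le.2 hp
  obtain ⟨r, hr⟩ := exists_ne (g s)
  obtain ⟨hc, hne, hagree⟩ := isCompleteScenario_update hg hr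
  by_contra! h
  refine hne (hT _ hc fun x hx => hagree x.1 x.2 ?_)
  rintro rfl
  exact h x.2 hx
end

section
/- Let n ≥ 2 and p ≥ 2. The teaching dimension of the class F_inc of incomplete scenarios equals n(n-1), i.e., TDim(F_inc) = n(n-1): every concept in F_inc has a teaching set of cardinality at most n(n-1), and some concept in F_inc has no teaching set of cardinality smaller than n(n-1). -/
open Finset

theorem card_pairs_mul_two (n : ℕ) : Fintype.card (Pairs n) * 2 = n * (n - 1) := by
  rw [Sym2.card_subtype_not_diag, Fintype.card_fin, Nat.choose_two_right]
  exact Nat.div_mul_cancel (Nat.even_mul_pred_self n).two_dvd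

/-- Two instances per pair suffice: an allowed relation together with any other relation. -/
theorem IsIncomplete.exists_isTeachingSet_card_le {n p : ℕ} (hp : 2 ≤ p)
    {f : QInstance n p → Bool} (hf : IsIncomplete f) :
    ∃ T : Finset (QInstance n p), IsTeachingSet IsIncomplete f T ∧ T.card ≤ n * (n - 1) := by
  obtain ⟨g, hg⟩ := hf
  have : Nontrivial (Fin p) := Fin.nontrivial_iff_two_le.2 hp
  have hab : ∀ s, ∃ a b : Fin p, b ≠ a ∧ (g s = none ∨ g s = some a) := by
    intro s
    cases hs : g s with
    | none =>
      obtain ⟨a, b, h⟩ := exists_pair_ne (Fin p)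
      exact ⟨a, b, h.symm, Or.inl rfl⟩
    | some a =>
      obtain ⟨b, h⟩ := exists_ne a
      exact ⟨a, b, h, Or.inr rfl⟩
  choose a b hne hga using hab
  refine ⟨univ.image (fun s => (s, a s)) ∪ univ.image (fun s => (s, b s)), ?_, ?_⟩
  · rintro f' ⟨g', hg'⟩ hT
    have hgg : ∀ s, g' s = g s := by
      intro s
      have ha : f' (s, a s) = f (s, a s) := hT _ (by simp)
      have hb : f' (s, b s) = f (s, b s) := hT _ (by simp)
      rw [Bool.eq_iff_iff, hg, hg'] at ha hb
      have := hne s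
      have := hga s
      grind
    funext ⟨s, r⟩
    rw [Bool.eq_iff_iff, hg, hg', hgg]
  · calc _ ≤ _ := card_union_le _ _
      _ ≤ Fintype.card (Pairs n) + Fintype.card (Pairs n) :=
        add_le_add card_image_le card_image_le
      _ = n * (n - 1) := by rw [← card_pairs_mul_two, mul_two]

/-- The concept placing no constraint on any pair requires two instances per pair. -/
theorem IsTeachingSet.le_card_of_const_true {n p : ℕ} (hp : 2 ≤ p)
    {T : Finset (QInstance n p)} (hT : IsTeachingSet IsIncomplete (fun _ => true) T) :
    n * (n - 1) ≤ T.card := by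
  have : Nontrivial (Fin p) := Fin.nontrivial_iff_two_le.2 hp
  rw [← card_pairs_mul_two, ← card_univ]
  rw [card_eq_sum_card_fiberwise (f := Prod.fst) (t := univ) (fun _ _ => mem_coe.2 (mem_univ _)),
    ← smul_eq_mul]
  refine card_nsmul_le_sum _ _ _ fun s _ => ?_
  by_contra! hlt
  have hr : ∃ r : Fin p, ∀ x ∈ T, x.1 = s → x.2 = r := by
    have h1 := card_le_one.1 (Nat.le_of_lt_succ hlt)
    by_cases hx : ∃ x ∈ T, x.1 = s
    · obtain ⟨x, hx, hxs⟩ := hx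
      exact ⟨x.2, fun y hy hys =>
        congrArg Prod.snd (h1 y (mem_filter.2 ⟨hy, hys⟩) x (mem_filter.2 ⟨hx, hxs⟩))⟩
    · push Not at hx
      exact ⟨⟨0, by lia⟩, fun x hxT hxs => absurd hxs (hx x hxT)⟩
  obtain ⟨r, hr⟩ := hr
  obtain ⟨r', hr'⟩ := exists_ne r
  have h := hT (fun x => decide (x.1 = s → x.2 = r))
    ⟨fun t => if t = s then some r else none, fun t q => by
      by_cases ht : t = s <;> simp [ht, eq_comm]⟩
    (fun x hx => decide_eq_true (hr x hx))
  have := congrFun h (s, r')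
  simp [hr'] at this

/-- `TDim(F_inc) = n(n-1)`. -/
theorem stmt_5 (n p : ℕ) (hn : 2 ≤ n) (hp : 2 ≤ p) :
    (∀ f : QInstance n p → Bool, IsIncomplete f →
      ∃ T : Finset (QInstance n p), IsTeachingSet IsIncomplete f T ∧ T.card ≤ n * (n - 1)) ∧
    (∃ f : QInstance n p → Bool, IsIncomplete f ∧
      ∀ T : Finset (QInstance n p), IsTeachingSet IsIncomplete f T → n * (n - 1) ≤ T.card) :=
  ⟨fun _ hf => hf.exists_isTeachingSet_card_le hp,
    fun _ => true, ⟨fun _ => none, by simp⟩, fun _ hT => hT.le_card_of_const_true hp⟩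
end

section
/- Let n ≥ 2 and p ≥ 2. Every concept f in the class F_inc of incomplete scenarios has a teaching set with respect to F_inc of cardinality at most n(n-1), obtained by choosing, for each pair s ∈ S, two instances (s,r) and (s,r') with r ≠ r' and f(s,r) = 1. -/
open Finset

/-- One positive instance and one further instance per pair determine an incomplete scenario. -/
lemma isTeachingSet_isIncomplete {n p : ℕ} {f : QInstance n p → Bool} (hf : IsIncomplete f)
    {ρ ρ' : Pairs n → Fin p} (hρ : ∀ s, ρ s ≠ ρ' s ∧ f (s, ρ s) = true) :
    IsTeachingSet IsIncomplete f
      (Finset.univ.biUnion fun s : Pairs n =>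
        ({(s, ρ s), (s, ρ' s)} : Finset (QInstance n p))) := by
  rintro f' ⟨g', hg'⟩ hagree
  obtain ⟨g, hg⟩ := hf
  have key : ∀ s, g' s = g s := by
    intro s
    have h₁ : f' (s, ρ s) = f (s, ρ s) :=
      hagree _ (Finset.mem_biUnion.2 ⟨s, Finset.mem_univ s, by simp⟩)
    have h₂ : f' (s, ρ' s) = f (s, ρ' s) :=
      hagree _ (Finset.mem_biUnion.2 ⟨s, Finset.mem_univ s, by simp⟩)
    have hne := (hρ s).1
    have hpos := (hg s (ρ s)).1 (hρ s).2
    have hpos' := (hg' s (ρ s)).1 (h₁.trans (hρ s).2)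
    have hiff := (hg' s (ρ' s)).symm.trans ((Bool.eq_iff_iff.1 h₂).trans (hg s (ρ' s)))
    rcases hpos with h | h <;> rcases hpos' with h' | h' <;> simp_all
  funext ⟨s, r⟩
  rw [Bool.eq_iff_iff, hg', hg, key]

lemma card_biUnion_two_instances_le {n p : ℕ} (ρ ρ' : Pairs n → Fin p) :
    (Finset.univ.biUnion fun s : Pairs n =>
      ({(s, ρ s), (s, ρ' s)} : Finset (QInstance n p))).card ≤ n * (n - 1) := by
  refine (Finset.card_biUnion_le_card_mul _ _ 2 fun s _ => Finset.card_le_two).trans ?_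
  rw [Finset.card_univ, Sym2.card_subtype_not_diag, Fintype.card_fin, Nat.choose_two_right,
    Nat.div_mul_cancel (Nat.even_mul_pred_self n).two_dvd]

/-- every incomplete scenario is taught by two instances per pair,
one of them positive, giving a teaching set of cardinality at most `n(n-1)`. -/
theorem stmt_6 (n p : ℕ) (hn : 2 ≤ n) (hp : 2 ≤ p)
    (f : QInstance n p → Bool) (hf : IsIncomplete f) :
    ∃ ρ ρ' : Pairs n → Fin p,
      (∀ s, ρ s ≠ ρ' s ∧ f (s, ρ s) = true) ∧
      IsTeachingSet IsIncomplete f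
        (Finset.univ.biUnion fun s : Pairs n =>
          ({(s, ρ s), (s, ρ' s)} : Finset (QInstance n p))) ∧
      (Finset.univ.biUnion fun s : Pairs n =>
          ({(s, ρ s), (s, ρ' s)} : Finset (QInstance n p))).card ≤ n * (n - 1) := by
  have : Nontrivial (Fin p) := Fin.nontrivial_iff_two_le.2 hp
  have hpos : ∀ s, ∃ r, f (s, r) = true := by
    obtain ⟨g, hg⟩ := hf
    intro s
    cases h : g s with
    | none => exact ⟨⟨0, by omega⟩, (hg s _).2 (Or.inl h)⟩
    | some r => exact ⟨r, (hg s r).2 (Or.inr h)⟩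
  choose ρ hρ using hpos
  choose ρ' hρ' using fun s => exists_ne (ρ s)
  have h : ∀ s, ρ s ≠ ρ' s ∧ f (s, ρ s) = true := fun s => ⟨(hρ' s).symm, hρ s⟩
  exact ⟨ρ, ρ', h, isTeachingSet_isIncomplete hf h, card_biUnion_two_instances_le ρ ρ'⟩
end

section
/- Let n ≥ 2 and p ≥ 2, and let f_U be the all-universal concept defined by f_U(x) = 1 for every x ∈ X. For every pair s₀ ∈ S and every relation r₀ ∈ R, the concept f' with witness g' defined by g'(s₀) = r₀ and g'(s) = ⊥ for s ≠ s₀ belongs to the class F_inc of incomplete scenarios, differs from f_U, agrees with f_U at (s₀, r₀), and agrees with f_U at every instance (s,r) with s ≠ s₀. Consequently, any teaching set for f_U with respect to F_inc must contain at least two instances on each pair s ∈ S. -/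
open Finset

/-- The concept of the incomplete scenario that is `r₀` on `s₀` and universal elsewhere. -/
def singlePairConcept {n p : ℕ} (s₀ : Pairs n) (r₀ : Fin p) : QInstance n p → Bool := fun x =>
  decide ((if x.1 = s₀ then some r₀ else none) = none ∨
    (if x.1 = s₀ then some r₀ else none) = some x.2)

theorem singlePairConcept_eq_true_iff {n p : ℕ} (s₀ : Pairs n) (r₀ : Fin p)
    (x : QInstance n p) : singlePairConcept s₀ r₀ x = true ↔ (x.1 = s₀ → x.2 = r₀) := by
  by_cases h : x.1 = s₀ <;> simp [singlePairConcept, h, eq_comm]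

theorem isIncomplete_singlePairConcept {n p : ℕ} (s₀ : Pairs n) (r₀ : Fin p) :
    IsIncomplete (singlePairConcept s₀ r₀) :=
  ⟨fun s => if s = s₀ then some r₀ else none, fun _ _ => decide_eq_true_iff⟩

theorem singlePairConcept_ne_true {n p : ℕ} (hp : 2 ≤ p) (s₀ : Pairs n) (r₀ : Fin p) :
    singlePairConcept s₀ r₀ ≠ fun _ => true := by
  intro h
  have : Nontrivial (Fin p) := Fin.nontrivial_iff_two_le.mpr hp
  obtain ⟨r, hr⟩ := exists_ne r₀
  exact hr ((singlePairConcept_eq_true_iff s₀ r₀ (s₀, r)).mp (congrFun h _) rfl)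

/-- A teaching set for the all-universal concept contains at least two instances on each pair. -/
theorem IsTeachingSet.two_le_card_filter {n p : ℕ} (hp : 2 ≤ p) {T : Finset (QInstance n p)}
    (hT : IsTeachingSet IsIncomplete (fun _ => true) T) (s : Pairs n) :
    2 ≤ (T.filter fun x => x.1 = s).card := by
  by_contra! hlt
  have : Nonempty (QInstance n p) := ⟨(s, ⟨0, by omega⟩)⟩
  obtain ⟨y, hy⟩ := Finset.card_le_one_iff_subset_singleton.mp (Nat.le_of_lt_succ hlt)
  refine singlePairConcept_ne_true hp s y.2 (hT _ (isIncomplete_singlePairConcept s y.2) ?_)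
  intro x hx
  refine (singlePairConcept_eq_true_iff s y.2 x).mpr fun hxs => ?_
  rw [Finset.mem_singleton.mp (hy (Finset.mem_filter.mpr ⟨hx, hxs⟩))]

/-- for any pair `s₀` and relation `r₀`, the incomplete scenario that is
`r₀` on `s₀` and universal elsewhere differs from the all-universal concept but agrees
with it at `(s₀, r₀)` and on all other pairs; hence a teaching set for the all-universal
concept needs at least two instances per pair. -/
theorem stmt_9 (n p : ℕ) (hn : 2 ≤ n) (hp : 2 ≤ p)
    (s₀ : Pairs n) (r₀ : Fin p) :
    (let g' : Pairs n → Option (Fin p) := fun s => if s = s₀ then some r₀ else none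
     let f' : QInstance n p → Bool := fun x => decide (g' x.1 = none ∨ g' x.1 = some x.2)
     IsIncomplete f' ∧ f' ≠ (fun _ => true) ∧ f' (s₀, r₀) = true ∧
       ∀ s r, s ≠ s₀ → f' (s, r) = true) ∧
    (∀ T : Finset (QInstance n p),
      IsTeachingSet IsIncomplete (fun _ => true) T →
        ∀ s : Pairs n, 2 ≤ (T.filter fun x => x.1 = s).card) := by
  exact ⟨⟨isIncomplete_singlePairConcept s₀ r₀, singlePairConcept_ne_true hp s₀ r₀,
    (singlePairConcept_eq_true_iff s₀ r₀ (s₀, r₀)).mpr fun _ => rfl,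
    fun s r hs => (singlePairConcept_eq_true_iff s₀ r₀ (s, r)).mpr fun h => absurd h hs⟩,
    fun _ hT => hT.two_le_card_filter hp⟩
end

section
/- Let n ≥ 2 and p ≥ 2. The teaching dimension of the class F_all of general QCN concepts equals the size of the instance space, i.e., TDim(F_all) = |X| = n(n-1)p/2: every concept in F_all has X itself as a teaching set, and some concept in F_all has no teaching set of cardinality smaller than |X|. -/
open Finset

theorem card_qInstance (n p : ℕ) :
    (Finset.univ : Finset (QInstance n p)).card = n * (n - 1) * p / 2 := by
  rw [Finset.card_univ, Fintype.card_prod, Sym2.card_subtype_not_diag, Fintype.card_fin,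
    Fintype.card_fin, Nat.choose_two_right,
    Nat.div_mul_right_comm (Nat.even_mul_pred_self n).two_dvd]

theorem isAll_of_forall_exists {n p : ℕ} {f : QInstance n p → Bool}
    (h : ∀ s, ∃ r, f (s, r) = true) : IsAll f :=
  ⟨fun s => Finset.univ.filter fun r => f (s, r) = true,
    fun s => (h s).imp fun r hr => by simpa using hr, fun s r => by simp⟩

theorem isAll_ne {n p : ℕ} (hp : 2 ≤ p) (x : QInstance n p) :
    IsAll fun y => decide (y ≠ x) := by
  have : Nontrivial (Fin p) := Fin.nontrivial_iff_two_le.mpr hp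
  refine isAll_of_forall_exists fun s => ?_
  obtain ⟨r, hr⟩ := exists_ne x.2
  exact ⟨r, decide_eq_true fun h => hr (congrArg Prod.snd h)⟩

theorem isAll_true {n p : ℕ} (hp : 2 ≤ p) : IsAll fun _ : QInstance n p => true :=
  isAll_of_forall_exists fun _ => ⟨⟨0, by omega⟩, rfl⟩

theorem eq_univ_of_isTeachingSet_true {n p : ℕ} (hp : 2 ≤ p) {T : Finset (QInstance n p)}
    (hT : IsTeachingSet IsAll (fun _ => true) T) : T = Finset.univ := by
  refine Finset.eq_univ_iff_forall.mpr fun x => ?_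
  by_contra hx
  have h := hT _ (isAll_ne hp x) fun y hy => decide_eq_true fun hyx => hx (hyx ▸ hy)
  simpa using congrFun h x

/-- `TDim(F_all) = |X| = n(n-1)p/2`. -/
theorem stmt_10 (n p : ℕ) (hn : 2 ≤ n) (hp : 2 ≤ p) :
    (Finset.univ : Finset (QInstance n p)).card = n * (n - 1) * p / 2 ∧
    (∀ f : QInstance n p → Bool, IsAll f → IsTeachingSet IsAll f Finset.univ) ∧
    (∃ f : QInstance n p → Bool, IsAll f ∧
      ∀ T : Finset (QInstance n p), IsTeachingSet IsAll f T → n * (n - 1) * p / 2 ≤ T.card) := by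
  refine ⟨card_qInstance n p, fun f _ f' _ h => funext fun x => h x (Finset.mem_univ x),
    fun _ => true, isAll_true hp, fun T hT => ?_⟩
  rw [eq_univ_of_isTeachingSet_true hp hT, card_qInstance]
end

section
/- Let n ≥ 2 and p ≥ 2, and let f_U be the all-universal concept defined by f_U(x) = 1 for every x ∈ X. For every instance x₀ = (s₀, r₀) ∈ X, the concept f' with witness g' defined by g'(s₀) = R \ {r₀} and g'(s) = R for s ≠ s₀ belongs to the class F_all of general QCN concepts, differs from f_U, and agrees with f_U on X \ {x₀}. Consequently, no proper subset of X is a teaching set for f_U with respect to F_all. -/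
open Finset

/-- Deleting one relation on one pair of the universal concept gives a general concept that
differs from the universal one exactly there. -/
theorem isAll_erase_single {n p : ℕ} (hp : 2 ≤ p) (s₀ : Pairs n) (r₀ : Fin p) :
    let g' : Pairs n → Finset (Fin p) :=
      fun s => if s = s₀ then Finset.univ.erase r₀ else Finset.univ
    let f' : QInstance n p → Bool := fun x => decide (x.2 ∈ g' x.1)
    IsAll f' ∧ f' ≠ (fun _ => true) ∧
      ∀ x : QInstance n p, x ≠ (s₀, r₀) → f' x = true := by
  intro g' f'
  have : Nontrivial (Fin p) := Fin.nontrivial_iff_two_le.mpr hp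
  refine ⟨⟨g', fun s => ?_, fun s r => by simp [f']⟩, fun h => ?_, ?_⟩
  · obtain ⟨r, hr⟩ := exists_ne r₀
    exact ⟨r, by by_cases hs : s = s₀ <;> simp [g', hs, hr]⟩
  · simpa [f', g'] using congrFun h (s₀, r₀)
  · rintro ⟨s, r⟩ hx
    by_cases hs : s = s₀
    · subst hs
      have hr : r ≠ r₀ := fun h => hx (by rw [h])
      simp [f', g', hr]
    · simp [f', g', hs]

/-- removing a single relation `r₀` on a single pair `s₀` yields a
general QCN concept differing from the all-universal one only at `(s₀, r₀)`;
hence no proper subset of `X` teaches the all-universal concept. -/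
theorem stmt_12 (n p : ℕ) (hn : 2 ≤ n) (hp : 2 ≤ p)
    (s₀ : Pairs n) (r₀ : Fin p) :
    (let g' : Pairs n → Finset (Fin p) :=
       fun s => if s = s₀ then Finset.univ.erase r₀ else Finset.univ
     let f' : QInstance n p → Bool := fun x => decide (x.2 ∈ g' x.1)
     IsAll f' ∧ f' ≠ (fun _ => true) ∧
       ∀ x : QInstance n p, x ≠ (s₀, r₀) → f' x = true) ∧
    (∀ T : Finset (QInstance n p), T ≠ Finset.univ →
      ¬ IsTeachingSet IsAll (fun _ => true) T) := by
  refine ⟨isAll_erase_single hp s₀ r₀, fun T hT hteach => ?_⟩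
  obtain ⟨⟨s, r⟩, hx⟩ : ∃ x, x ∉ T := by
    simpa [Finset.eq_univ_iff_forall] using hT
  obtain ⟨hall, hne, hagree⟩ := isAll_erase_single hp s r
  exact hne (hteach _ hall fun y hy => hagree y fun h => hx (h ▸ hy))
end
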